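/- arXiv:2303.00250 — 5 statements merged into one kernel-verified Lean document; each statement's English description precedes it below -/
import Mathlib

section
/- Let E and F be real inner product spaces, λ > 0 and L_{xθ} ≥ 0. Let f : E × F → ℝ be such that for every θ ∈ E the function f(θ, ·) : F → ℝ is differentiable with gradient ∇_x f(θ, ·) and is λ-strongly concave (i.e., x ↦ −f(θ, x) − (λ/2)‖x‖² is convex), and let x* : E → F satisfy the first-order optimality condition ∇_x f(θ, x*(θ)) = 0 for every θ. Assume the cross-Lipschitz condition ‖∇_x f(θ_1, x) − ∇_x f(θ_2, x)‖ ≤ L_{xθ}·‖θ_1 − θ_2‖ for all θ_1, θ_2 ∈ E and x ∈ F. Then the maximizer map is Lipschitz: ‖x*(θ_1) − x*(θ_2)‖ ≤ (L_{xθ}/λ)·‖θ_1 − θ_2‖ for all θ_1, θ_2 ∈ E. -/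
/-- The supporting hyperplane inequality for a differentiable convex function. -/
theorem ConvexOn.add_hasFDerivAt_le {F : Type*} [NormedAddCommGroup F] [NormedSpace ℝ F]
    {h : F → ℝ} (hh : ConvexOn ℝ Set.univ h) {h' : F →L[ℝ] ℝ} {x : F}
    (hx : HasFDerivAt h h' x) (y : F) : h x + h' (y - x) ≤ h y := by
  have hline : HasDerivAt (fun t : ℝ => h (AffineMap.lineMap x y t)) (h' (y - x)) 0 := by
    refine HasFDerivAt.comp_hasDerivAt (0 : ℝ) ?_ AffineMap.hasDerivAt_lineMap
    simpa using hx
  have hconv : ConvexOn ℝ Set.univ (fun t : ℝ => h (AffineMap.lineMap x y t)) :=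
    hh.comp_affineMap (AffineMap.lineMap x y)
  have hslope := hconv.le_slope_of_hasDerivAt (Set.mem_univ 0) (Set.mem_univ 1) one_pos hline
  simp only [slope_def_field, AffineMap.lineMap_apply_one, AffineMap.lineMap_apply_zero,
    sub_zero, div_one] at hslope
  linarith

/-- The gradient of an `m`-strongly concave function is strongly antitone. -/
theorem mul_norm_sub_sq_le_inner_gradient_sub {F : Type*} [NormedAddCommGroup F]
    [InnerProductSpace ℝ F] [CompleteSpace F] {m : ℝ} {φ : F → ℝ} {g : F → F}
    (hφ : ∀ x, HasGradientAt φ (g x) x)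
    (hconc : ConvexOn ℝ Set.univ (fun x => -φ x - (m / 2) * ‖x‖ ^ 2)) (x y : F) :
    m * ‖x - y‖ ^ 2 ≤ inner ℝ (g y - g x) (x - y) := by
  have hderiv (z : F) := (hφ z).hasFDerivAt.neg.sub
    ((hasStrictFDerivAt_norm_sq z).hasFDerivAt.const_mul (m / 2))
  have hxy := hconc.add_hasFDerivAt_le (hderiv x) y
  have hyx := hconc.add_hasFDerivAt_le (hderiv y) x
  simp only [sub_apply, neg_apply,
    smul_apply, InnerProductSpace.toDual_apply_apply, innerSL_apply_apply,
    smul_eq_mul, nsmul_eq_mul, Nat.cast_ofNat, inner_sub_right, inner_sub_left,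
    real_inner_self_eq_norm_sq, real_inner_comm x y] at hxy hyx ⊢
  rw [norm_sub_sq_real]
  linarith [real_inner_comm x y]

/-- Lemma D.1, first conclusion: the argmax map of a λ-strongly concave inner
problem is `(L_{xθ}/λ)`-Lipschitz under the cross-Lipschitz gradient condition. -/
theorem argmax_map_lipschitz
    {E F : Type*} [NormedAddCommGroup E] [InnerProductSpace ℝ E]
    [NormedAddCommGroup F] [InnerProductSpace ℝ F] [CompleteSpace F]
    (lam Lxθ : ℝ) (hlam : 0 < lam) (hLxθ : 0 ≤ Lxθ)
    (f : E → F → ℝ) (gx : E → F → F)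
    (hgrad : ∀ θ x, HasGradientAt (f θ) (gx θ x) x)
    (hconc : ∀ θ, ConvexOn ℝ Set.univ (fun x => -f θ x - (lam / 2) * ‖x‖ ^ 2))
    (xstar : E → F)
    (hfoc : ∀ θ, gx θ (xstar θ) = 0)
    (hcross : ∀ θ₁ θ₂ x, ‖gx θ₁ x - gx θ₂ x‖ ≤ Lxθ * ‖θ₁ - θ₂‖) :
    ∀ θ₁ θ₂ : E, ‖xstar θ₁ - xstar θ₂‖ ≤ (Lxθ / lam) * ‖θ₁ - θ₂‖ := by
  intro θ₁ θ₂
  have hmono := mul_norm_sub_sq_le_inner_gradient_sub (hgrad θ₁) (hconc θ₁) (xstar θ₁) (xstar θ₂)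
  have hnorm : ‖gx θ₁ (xstar θ₂)‖ ≤ Lxθ * ‖θ₁ - θ₂‖ := by
    simpa [hfoc θ₂] using hcross θ₁ θ₂ (xstar θ₂)
  rw [hfoc θ₁, sub_zero] at hmono
  rw [div_mul_eq_mul_div, le_div_iff₀ hlam]
  rcases (norm_nonneg (xstar θ₁ - xstar θ₂)).eq_or_lt with hzero | hpos
  · rw [← hzero, zero_mul]
    positivity
  · refine le_of_mul_le_mul_right ?_ hpos
    calc ‖xstar θ₁ - xstar θ₂‖ * lam * ‖xstar θ₁ - xstar θ₂‖
        = lam * ‖xstar θ₁ - xstar θ₂‖ ^ 2 := by ring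
      _ ≤ inner ℝ (gx θ₁ (xstar θ₂)) (xstar θ₁ - xstar θ₂) := hmono
      _ ≤ ‖gx θ₁ (xstar θ₂)‖ * ‖xstar θ₁ - xstar θ₂‖ := real_inner_le_norm _ _
      _ ≤ Lxθ * ‖θ₁ - θ₂‖ * ‖xstar θ₁ - xstar θ₂‖ := by gcongr
end

section
/- Let H be a real inner product space and F : H → ℝ a differentiable function whose gradient ∇F is Lipschitz with constant L > 0. Let θ, h, ζ ∈ H, let 0 < μ ≤ 1/L, and set θ⁺ = θ − μ·(h + ζ). Then F(θ⁺) ≤ F(θ) − (μ/2)·‖∇F(θ)‖² + μ·(1 − Lμ)·⟨∇F(θ), ∇F(θ) − h⟩ + (μ·(1 + Lμ)/2)·‖ζ‖² + L·μ²·‖h − ∇F(θ)‖². -/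
open scoped RealInnerProductSpace

/-- The descent lemma: a function with `L`-Lipschitz gradient lies below its quadratic upper
model. -/
theorem le_add_inner_add_sq_of_lipschitz_gradient
    {H : Type*} [NormedAddCommGroup H] [InnerProductSpace ℝ H] [CompleteSpace H]
    {L : ℝ} {F : H → ℝ} {gradF : H → H}
    (hgrad : ∀ x, HasGradientAt F (gradF x) x)
    (hLip : ∀ x y, ‖gradF x - gradF y‖ ≤ L * ‖x - y‖) (x v : H) :
    F (x + v) ≤ F x + ⟪gradF x, v⟫ + L / 2 * ‖v‖ ^ 2 := by
  have hf (t : ℝ) : HasDerivAt (fun s : ℝ => F (x + s • v)) ⟪gradF (x + t • v), v⟫ t := by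
    have hline : HasDerivAt (fun s : ℝ => x + s • v) v t := by
      simpa using ((hasDerivAt_id t).smul_const v).const_add x
    simpa [Function.comp_def] using (hgrad (x + t • v)).hasFDerivAt.comp_hasDerivAt t hline
  have hB (t : ℝ) : HasDerivAt (fun s : ℝ => F x + s * ⟪gradF x, v⟫ + L / 2 * ‖v‖ ^ 2 * s ^ 2)
      (⟪gradF x, v⟫ + L * t * ‖v‖ ^ 2) t := by
    refine ((((hasDerivAt_id t).mul_const ⟪gradF x, v⟫).const_add (F x)).add
      ((hasDerivAt_pow 2 t).const_mul (L / 2 * ‖v‖ ^ 2))).congr_deriv ?_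
    norm_num
    ring
  have hbound (t : ℝ) (ht : 0 ≤ t) :
      ⟪gradF (x + t • v), v⟫ ≤ ⟪gradF x, v⟫ + L * t * ‖v‖ ^ 2 := by
    have hdiff : ‖gradF (x + t • v) - gradF x‖ ≤ L * (t * ‖v‖) := by
      simpa [norm_smul, abs_of_nonneg ht] using hLip (x + t • v) x
    have hinner := (real_inner_le_norm (gradF (x + t • v) - gradF x) v).trans
      (mul_le_mul_of_nonneg_right hdiff (norm_nonneg v))
    rw [inner_sub_left] at hinner
    linarith
  have h1 := image_le_of_deriv_right_le_deriv_boundary (a := 0) (b := 1)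
    (fun t _ => (hf t).continuousAt.continuousWithinAt) (fun t _ => (hf t).hasDerivWithinAt)
    (by simp) (fun t _ => (hB t).continuousAt.continuousWithinAt)
    (fun t _ => (hB t).hasDerivWithinAt) (fun t ht => hbound t ht.1)
    (Set.right_mem_Icc.2 zero_le_one)
  simpa using h1

/-- Per-step descent inequality (Eq. (29)) for gradient descent with an inexact
gradient `h + ζ` on an `L`-smooth function. -/
theorem inexact_gradient_descent_step
    {H : Type*} [NormedAddCommGroup H] [InnerProductSpace ℝ H] [CompleteSpace H]
    (L : ℝ) (hL : 0 < L)
    (F : H → ℝ) (gradF : H → H)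
    (hgrad : ∀ x, HasGradientAt F (gradF x) x)
    (hLip : ∀ x y, ‖gradF x - gradF y‖ ≤ L * ‖x - y‖)
    (θ h ζ : H) (μ : ℝ) (hμ0 : 0 < μ) (hμL : μ ≤ 1 / L) :
    F (θ - μ • (h + ζ))
      ≤ F θ - (μ / 2) * ‖gradF θ‖ ^ 2
        + μ * (1 - L * μ) * ⟪gradF θ, gradF θ - h⟫
        + (μ * (1 + L * μ) / 2) * ‖ζ‖ ^ 2
        + L * μ ^ 2 * ‖h - gradF θ‖ ^ 2 := by
  have hLμ : 0 ≤ 1 - L * μ := by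
    rw [le_div_iff₀ hL] at hμL
    linarith
  have hdescent := le_add_inner_add_sq_of_lipschitz_gradient hgrad hLip θ (-(μ • (h + ζ)))
  rw [← sub_eq_add_neg] at hdescent
  have hgap : 0 ≤ μ * ((1 - L * μ) / 2 * ‖gradF θ + ζ‖ ^ 2
      + L * μ / 2 * ‖h - gradF θ - ζ‖ ^ 2) := by positivity
  refine hdescent.trans ?_
  simp only [← real_inner_self_eq_norm_sq, inner_add_left, inner_add_right, inner_sub_left,
    inner_sub_right, inner_neg_left, inner_neg_right, real_inner_smul_left,
    real_inner_smul_right] at hgap ⊢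
  rw [real_inner_comm (gradF θ) h, real_inner_comm (gradF θ) ζ, real_inner_comm h ζ] at *
  linarith
end

section
/- Let T ≥ 1 be a natural number and let Δ, L, δ > 0 be real numbers with T ≥ L·Δ/δ², and set μ = √(Δ/(L·T·δ²)). Let ε̂ ≥ 0, and suppose real numbers F_1, …, F_{T+1} and a_1, …, a_T satisfy a_t − 2ε̂ ≤ (2/μ)·(F_t − F_{t+1}) + 2·L·μ·δ² for each t = 1, …, T, and F_1 − F_{T+1} ≤ Δ. Then μ ≤ 1/L and (1/T)·Σ_{t=1}^{T} a_t ≤ 2ε̂ + 4δ·√(L·Δ/T). -/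
/-- Telescoping-and-stepsize step concluding the per-client bound in the proof
of Theorem 2. -/
theorem telescoping_stepsize_bound
    (T : ℕ) (hT : 1 ≤ T)
    (Δ L δ : ℝ) (hΔ : 0 < Δ) (hL : 0 < L) (hδ : 0 < δ)
    (hTge : L * Δ / δ ^ 2 ≤ (T : ℝ))
    (μ : ℝ) (hμ : μ = Real.sqrt (Δ / (L * T * δ ^ 2)))
    (εhat : ℝ) (hεhat : 0 ≤ εhat)
    (F a : ℕ → ℝ)
    (hstep : ∀ t ∈ Finset.Icc 1 T,
      a t - 2 * εhat ≤ (2 / μ) * (F t - F (t + 1)) + 2 * L * μ * δ ^ 2)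
    (hinit : F 1 - F (T + 1) ≤ Δ) :
    μ ≤ 1 / L ∧
      (1 / (T : ℝ)) * ∑ t ∈ Finset.Icc 1 T, a t
        ≤ 2 * εhat + 4 * δ * Real.sqrt (L * Δ / T) := by
  have hT0 : (0 : ℝ) < T := by exact_mod_cast hT
  have hμ0 : 0 < μ := by rw [hμ]; positivity
  have hμ2 : μ ^ 2 = Δ / (L * T * δ ^ 2) := by rw [hμ]; exact Real.sq_sqrt (by positivity)
  have hΔμ : Δ = μ ^ 2 * (L * T * δ ^ 2) := by rw [hμ2]; field_simp
  have hsqrt : Real.sqrt (L * Δ / T) = L * μ * δ := by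
    rw [Real.sqrt_eq_iff_mul_self_eq (by positivity) (by positivity), hΔμ]
    field_simp
  have htel : ∑ t ∈ Finset.Icc 1 T, (F t - F (t + 1)) = F 1 - F (T + 1) := by
    rw [← Finset.Ico_add_one_right_eq_Icc, ← neg_inj, ← Finset.sum_neg_distrib]
    simpa using Finset.sum_Ico_sub F (Nat.le_add_left 1 T)
  constructor
  · rw [div_le_iff₀ (by positivity)] at hTge
    refine (sq_le_sq₀ hμ0.le (by positivity)).mp ?_
    rw [hμ2, div_pow, div_le_div_iff₀ (by positivity) (by positivity)]
    nlinarith [mul_le_mul_of_nonneg_left hTge hL.le]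
  · have hsum := Finset.sum_le_sum hstep
    simp only [Finset.sum_sub_distrib, Finset.sum_add_distrib, ← Finset.mul_sum,
      Finset.sum_const, Nat.card_Icc, Nat.add_sub_cancel, nsmul_eq_mul] at hsum htel
    rw [htel] at hsum
    have hbound : 2 / μ * (F 1 - F (T + 1)) ≤ 2 * (L * μ * T * δ ^ 2) :=
      calc 2 / μ * (F 1 - F (T + 1)) ≤ 2 / μ * Δ := by gcongr
        _ = 2 * (L * μ * T * δ ^ 2) := by rw [hΔμ]; field_simp
    rw [hsqrt, one_div, inv_mul_le_iff₀ hT0]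
    linarith
end

section
/- Let H be a real inner product space, K ≥ 1, and weights w_1, …, w_K ≥ 0 with Σ_k w_k = 1. Let c ∈ H, let Ē ≥ 1 and m be natural numbers with m ≤ Ē − 1, let ς ≥ 0 and η > 0, and let η_1, …, η_m > 0 be stepsizes with η_τ ≤ 2η for every τ. For each k, let g_{k,1}, …, g_{k,m} ∈ H with ‖g_{k,τ}‖ ≤ ς, and set θ_k = c − Σ_{τ=1}^{m} η_τ·g_{k,τ} and θ̄ = Σ_{k=1}^{K} w_k·θ_k. Then Σ_{k=1}^{K} w_k·‖θ_k − θ̄‖² ≤ 4·η²·(Ē − 1)²·ς². -/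
/-- The weighted mean minimizes the weighted sum of squared distances to a point. -/
theorem sum_mul_norm_sub_weighted_mean_sq_le {ι H : Type*} [Fintype ι]
    [NormedAddCommGroup H] [InnerProductSpace ℝ H] (w : ι → ℝ) (hw : ∑ i, w i = 1)
    (x : ι → H) (c : H) :
    ∑ i, w i * ‖x i - ∑ j, w j • x j‖ ^ 2 ≤ ∑ i, w i * ‖x i - c‖ ^ 2 := by
  set b := ∑ j, w j • x j with hb
  have hexpand : ∀ i, w i * ‖x i - c‖ ^ 2 =
      w i * ‖x i - b‖ ^ 2 + 2 * inner ℝ (w i • (x i - b)) (b - c) + w i * ‖b - c‖ ^ 2 := by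
    intro i
    rw [← sub_add_sub_cancel (x i) b c, norm_add_sq_real, real_inner_smul_left]
    ring
  have hcentered : ∑ i, w i • (x i - b) = 0 := by
    simp only [smul_sub, Finset.sum_sub_distrib, ← Finset.sum_smul, hw, one_smul, ← hb, sub_self]
  simp only [hexpand, Finset.sum_add_distrib, ← Finset.mul_sum, ← Finset.sum_mul, ← sum_inner,
    hcentered, hw, inner_zero_left]
  nlinarith [sq_nonneg ‖b - c‖]

/-- A linear combination of vectors of norm at most `r` with coefficients in `[0, a]` has norm at
most the number of terms times `a * r`. -/
theorem norm_sum_smul_le_card_mul {ι E : Type*} [Fintype ι] [SeminormedAddCommGroup E]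
    [NormedSpace ℝ E] {a r : ℝ} {u : ι → ℝ} {v : ι → E} (ha : 0 ≤ a) (hu₀ : ∀ i, 0 ≤ u i)
    (hu : ∀ i, u i ≤ a) (hv : ∀ i, ‖v i‖ ≤ r) :
    ‖∑ i, u i • v i‖ ≤ Fintype.card ι * (a * r) := by
  refine (norm_sum_le_of_le (f := fun i => u i • v i) (n := fun _ => a * r) Finset.univ ?_).trans
    (by simp)
  intro i _
  rw [norm_smul, Real.norm_of_nonneg (hu₀ i)]
  exact mul_le_mul (hu i) (hv i) (norm_nonneg _) ha


/-- Deterministic core of Lemma B.3: bounding the divergence of local iterates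
from their weighted average after at most `Ē − 1` local steps. -/
theorem local_iterate_divergence_bound
    {H : Type*} [NormedAddCommGroup H] [InnerProductSpace ℝ H]
    (K : ℕ) (hK : 1 ≤ K)
    (w : Fin K → ℝ) (hw : ∀ k, 0 ≤ w k) (hw1 : ∑ k, w k = 1)
    (c : H) (Ebar m : ℕ) (hE : 1 ≤ Ebar) (hm : m ≤ Ebar - 1)
    (ς η : ℝ) (hς : 0 ≤ ς) (hη : 0 < η)
    (ηs : Fin m → ℝ) (hηs0 : ∀ τ, 0 < ηs τ) (hηs : ∀ τ, ηs τ ≤ 2 * η)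
    (g : Fin K → Fin m → H) (hg : ∀ k τ, ‖g k τ‖ ≤ ς)
    (θ : Fin K → H) (hθ : ∀ k, θ k = c - ∑ τ, ηs τ • g k τ)
    (θbar : H) (hθbar : θbar = ∑ k, w k • θ k) :
    ∑ k, w k * ‖θ k - θbar‖ ^ 2 ≤ 4 * η ^ 2 * ((Ebar : ℝ) - 1) ^ 2 * ς ^ 2 := by
  have hm' : (m : ℝ) ≤ Ebar - 1 := by
    have : m + 1 ≤ Ebar := by omega
    rw [le_sub_iff_add_le]
    exact_mod_cast this
  have hdist : ∀ k, ‖θ k - c‖ ≤ ((Ebar : ℝ) - 1) * (2 * η * ς) := by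
    intro k
    rw [hθ k, sub_sub_cancel_left, norm_neg]
    refine (norm_sum_smul_le_card_mul (by positivity) (fun τ => (hηs0 τ).le) hηs (hg k)).trans ?_
    rw [Fintype.card_fin]
    gcongr
  rw [hθbar]
  calc ∑ k, w k * ‖θ k - ∑ j, w j • θ j‖ ^ 2
      ≤ ∑ k, w k * ‖θ k - c‖ ^ 2 := sum_mul_norm_sub_weighted_mean_sq_le w hw1 θ c
    _ ≤ ∑ k, w k * (((Ebar : ℝ) - 1) * (2 * η * ς)) ^ 2 := by
        gcongr with k
        · exact hw k
        · exact hdist k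
    _ = 4 * η ^ 2 * ((Ebar : ℝ) - 1) ^ 2 * ς ^ 2 := by
        rw [← Finset.sum_mul, hw1]
        ring
end

section
/- Let λ > 0, B ≥ 0, β > 1/λ and γ > 0 be real numbers with γ + 1 ≥ β·λ. Let Δ_1, Δ_2, … be nonnegative reals satisfying Δ_{t+1} ≤ (1 − λ·β/(γ+t))·Δ_t + β²·B/(γ+t)² for all t ≥ 1. Then, with ν = max{β²·B/(β·λ − 1), (γ+1)·Δ_1}, one has Δ_t ≤ ν/(γ+t) for all t ≥ 1. -/
/-- Key induction lemma in the proof of Theorem 3: the recursion with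
diminishing stepsize implies the `ν/(γ+t)` decay. -/
theorem diminishing_stepsize_induction
    (lam B β γ : ℝ) (hlam : 0 < lam) (hB : 0 ≤ B)
    (hβ : 1 / lam < β) (hγ : 0 < γ) (hγβ : β * lam ≤ γ + 1)
    (Δ : ℕ → ℝ) (hΔ : ∀ t, 0 ≤ Δ t)
    (hrec : ∀ t : ℕ, 1 ≤ t →
      Δ (t + 1) ≤ (1 - lam * β / (γ + t)) * Δ t + β ^ 2 * B / (γ + t) ^ 2) :
    ∀ t : ℕ, 1 ≤ t →
      Δ t ≤ max (β ^ 2 * B / (β * lam - 1)) ((γ + 1) * Δ 1) / (γ + t) := by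
  have hc : 0 < β * lam - 1 := by
    rw [div_lt_iff₀ hlam] at hβ
    linarith
  set ν := max (β ^ 2 * B / (β * lam - 1)) ((γ + 1) * Δ 1)
  have hK : β ^ 2 * B ≤ ν * (β * lam - 1) := (div_le_iff₀ hc).1 (le_max_left _ _)
  have hν : 0 ≤ ν := le_trans (by positivity) (le_max_left _ _)
  intro t ht
  induction t, ht using Nat.le_induction with
  | base =>
    rw [Nat.cast_one, le_div_iff₀ (by linarith), mul_comm]
    exact le_max_right _ _
  | succ t ht ih =>
    have hs₁ : γ + 1 ≤ γ + (t : ℝ) := by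
      gcongr
      exact_mod_cast ht
    have hr := hrec t ht
    push_cast
    rw [← add_assoc]
    generalize γ + (t : ℝ) = s at *
    have hs : 0 < s := by linarith
    have hcoef : 0 ≤ 1 - lam * β / s := by
      rw [sub_nonneg, div_le_one hs]
      linarith
    calc Δ (t + 1) ≤ (1 - lam * β / s) * Δ t + β ^ 2 * B / s ^ 2 := hr
      _ ≤ (1 - lam * β / s) * (ν / s) + ν * (β * lam - 1) / s ^ 2 := by gcongr
      _ = ν * (s - 1) / s ^ 2 := by
        field_simp
        ring
      _ ≤ ν / (s + 1) := by
        rw [div_le_div_iff₀ (by positivity) (by linarith)]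
        nlinarith
end
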